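/- The weighted norm with the balanced weight is balanced for the interior layer (Remark 2.1, interior case): for the interior layer function w₂(x) = e^{−α|x−1|/ε} on [0,2], whose derivative exists for x ≠ 1, and the weight β_b(x) := 1 + (1/ε)(e^{−αx/ε} + e^{−α|x−1|/ε} + e^{−α(2−x)/ε}), one has for all ε ∈ (0,1] the ε-independent lower bound ε²∫₀² β_b(x)w₂′(x)² dx + γ∫₀² β_b(x)w₂(x)² dx ≥ (2α/3)(1 − e^{−3α}). -/

import Mathlib

open Real Set

lemma aux_deriv (α ε x : ℝ) (hx : x ≠ 1) :
    (deriv (fun y => Real.exp (-(α * |y - 1|) / ε)) x) ^ 2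
      = (α / ε) ^ 2 * (Real.exp (-(α * |x - 1|) / ε)) ^ 2 := by
  rcases lt_or_gt_of_ne hx with h | h
  · have h1 : (fun y => Real.exp (-(α * |y - 1|) / ε)) =ᶠ[nhds x]
        (fun y => Real.exp (α / ε * (y - 1))) := by
      filter_upwards [Iio_mem_nhds h] with y hy
      rw [abs_of_neg (sub_neg.2 hy)]
      congr 1; ring
    have h2 : HasDerivAt (fun y => Real.exp (α / ε * (y - 1)))
        (Real.exp (α / ε * (x - 1)) * (α / ε * 1)) x :=
      (((hasDerivAt_id x).sub_const 1).const_mul (α / ε)).exp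
    rw [h1.deriv_eq, h2.deriv, h1.eq_of_nhds]
    ring
  · have h1 : (fun y => Real.exp (-(α * |y - 1|) / ε)) =ᶠ[nhds x]
        (fun y => Real.exp (-(α / ε) * (y - 1))) := by
      filter_upwards [Ioi_mem_nhds h] with y hy
      rw [abs_of_pos (sub_pos.2 hy)]
      congr 1; ring
    have h2 : HasDerivAt (fun y => Real.exp (-(α / ε) * (y - 1)))
        (Real.exp (-(α / ε) * (x - 1)) * (-(α / ε) * 1)) x :=
      (((hasDerivAt_id x).sub_const 1).const_mul (-(α / ε))).exp
    rw [h1.deriv_eq, h2.deriv, h1.eq_of_nhds]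
    ring

lemma aux_exp (c a b : ℝ) (hc : c ≠ 0) :
    ∫ x in a..b, Real.exp (c * (x - 1))
      = (Real.exp (c * (b - 1)) - Real.exp (c * (a - 1))) / c := by
  rw [intervalIntegral.integral_eq_sub_of_hasDerivAt
    (f := fun x => Real.exp (c * (x - 1)) / c)]
  · ring
  · intro x _
    have h2 : HasDerivAt (fun x => Real.exp (c * (x - 1)) / c)
        (Real.exp (c * (x - 1)) * (c * 1) / c) x :=
      ((((hasDerivAt_id x).sub_const 1).const_mul c).exp).div_const c
    have h3 : Real.exp (c * (x - 1)) * (c * 1) / c = Real.exp (c * (x - 1)) := by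
      field_simp
    rwa [h3] at h2
  · exact Continuous.intervalIntegrable (by fun_prop) _ _

lemma aux_cube (c : ℝ) (hc : c ≠ 0) :
    ∫ x in (0:ℝ)..2, Real.exp (-c * |x - 1|) = 2 / c * (1 - Real.exp (-c)) := by
  have hcont : Continuous (fun x : ℝ => Real.exp (-c * |x - 1|)) := by fun_prop
  rw [← intervalIntegral.integral_add_adjacent_intervals
    (hcont.intervalIntegrable 0 1) (hcont.intervalIntegrable 1 2)]
  have e1 : ∫ x in (0:ℝ)..1, Real.exp (-c * |x - 1|) = ∫ x in (0:ℝ)..1, Real.exp (c * (x - 1)) := by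
    apply intervalIntegral.integral_congr
    intro x hx
    rw [uIcc_of_le (by norm_num)] at hx
    simp only []
    rw [abs_of_nonpos (by linarith [hx.2])]
    congr 1; ring
  have e2 : ∫ x in (1:ℝ)..2, Real.exp (-c * |x - 1|) = ∫ x in (1:ℝ)..2, Real.exp (-c * (x - 1)) := by
    apply intervalIntegral.integral_congr
    intro x hx
    rw [uIcc_of_le (by norm_num)] at hx
    simp only []
    rw [abs_of_nonneg (by linarith [hx.1])]
  rw [e1, e2, aux_exp c _ _ hc, aux_exp (-c) _ _ (neg_ne_zero.2 hc)]
  have : c * (0 - 1) = -c := by ring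
  have h2 : -c * (2 - 1) = -c := by ring
  rw [this, h2]
  simp only [sub_self, mul_zero, Real.exp_zero]
  field_simp
  ring

/-- The weighted norm with the balanced weight is balanced for the interior layer
(Remark 2.1, interior case): `ε`-independent lower bound `(2α/3)(1 - e^{-3α})`. -/
theorem balanced_norm_interior_layer
    (α γ ε : ℝ) (hα : 0 < α) (hγ : 0 < γ) (hε : ε ∈ Set.Ioc (0:ℝ) 1) :
    2 * α / 3 * (1 - Real.exp (-(3 * α)))
      ≤ ε ^ 2 * (∫ x in (0:ℝ)..2,
            (1 + 1 / ε * (Real.exp (-(α * x) / ε) + Real.exp (-(α * |x - 1|) / ε)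
              + Real.exp (-(α * (2 - x)) / ε)))
            * (deriv (fun y => Real.exp (-(α * |y - 1|) / ε)) x) ^ 2)
        + γ * (∫ x in (0:ℝ)..2,
            (1 + 1 / ε * (Real.exp (-(α * x) / ε) + Real.exp (-(α * |x - 1|) / ε)
              + Real.exp (-(α * (2 - x)) / ε)))
            * (Real.exp (-(α * |x - 1|) / ε)) ^ 2) := by
  obtain ⟨h0, h1⟩ := hε
  set J := ∫ x in (0:ℝ)..2,
            (1 + 1 / ε * (Real.exp (-(α * x) / ε) + Real.exp (-(α * |x - 1|) / ε)
              + Real.exp (-(α * (2 - x)) / ε)))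
            * (Real.exp (-(α * |x - 1|) / ε)) ^ 2 with hJ
  have hI : (∫ x in (0:ℝ)..2,
            (1 + 1 / ε * (Real.exp (-(α * x) / ε) + Real.exp (-(α * |x - 1|) / ε)
              + Real.exp (-(α * (2 - x)) / ε)))
            * (deriv (fun y => Real.exp (-(α * |y - 1|) / ε)) x) ^ 2) = (α / ε) ^ 2 * J := by
    rw [hJ, ← intervalIntegral.integral_const_mul]
    apply intervalIntegral.integral_congr_ae
    have : ∀ᵐ x : ℝ, x ≠ 1 := by
      simp [MeasureTheory.ae_iff]
    filter_upwards [this] with x hx _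
    rw [aux_deriv α ε x hx]
    ring
  have hJ1 : 2 / (3 * α) * (1 - Real.exp (-(3 * α / ε))) ≤ J := by
    have hc := aux_cube (3 * α / ε) (by positivity)
    have hK : ∫ x in (0:ℝ)..2, 1 / ε * Real.exp (-(3 * α / ε) * |x - 1|)
        = 2 / (3 * α) * (1 - Real.exp (-(3 * α / ε))) := by
      rw [intervalIntegral.integral_const_mul, hc]
      field_simp
    rw [← hK, hJ]
    apply intervalIntegral.integral_mono_on (by norm_num)
    · exact Continuous.intervalIntegrable (by fun_prop) _ _
    · exact Continuous.intervalIntegrable (by fun_prop) _ _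
    · intro x _
      have e : Real.exp (-(3 * α / ε) * |x - 1|) = Real.exp (-(α * |x - 1|) / ε)
          * Real.exp (-(α * |x - 1|) / ε) ^ 2 := by
        rw [← Real.exp_nat_mul, ← Real.exp_add]
        congr 1; push_cast; ring
      rw [e, ← mul_assoc]
      apply mul_le_mul_of_nonneg_right _ (by positivity)
      have p1 := Real.exp_pos (-(α * x) / ε)
      have p2 := Real.exp_pos (-(α * (2 - x)) / ε)
      have p3 : 0 < 1 / ε := by positivity
      nlinarith [mul_pos p3 p1, mul_pos p3 p2]
  have hexp : Real.exp (-(3 * α / ε)) ≤ Real.exp (-(3 * α)) := by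
    apply Real.exp_le_exp.2
    have : 3 * α ≤ 3 * α / ε := by
      rw [le_div_iff₀ h0]; nlinarith
    linarith
  have hlt : Real.exp (-(3 * α)) < 1 := by
    rw [Real.exp_lt_one_iff]; linarith
  have hJ2 : 2 / (3 * α) * (1 - Real.exp (-(3 * α))) ≤ J :=
    le_trans (mul_le_mul_of_nonneg_left (by linarith) (by positivity)) hJ1
  have hJ0 : 0 ≤ J :=
    le_trans (mul_nonneg (by positivity) (by linarith)) hJ2
  rw [hI]
  have e3 : ε ^ 2 * ((α / ε) ^ 2 * J) = α ^ 2 * J := by field_simp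
  have e4 : 2 * α / 3 * (1 - Real.exp (-(3 * α)))
      = α ^ 2 * (2 / (3 * α) * (1 - Real.exp (-(3 * α)))) := by field_simp
  rw [e3, e4]
  have := mul_le_mul_of_nonneg_left hJ2 (sq_nonneg α)
  have := mul_nonneg hγ.le hJ0
  linarith
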